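/- Let n, m ∈ ℕ, c, c₁, σ₁ > 0, let L_e ∈ ℝ^{n×n}, B ∈ ℝ^{n×m} with zᵀ(c₁I + cL_e)z ≥ c₁′‖z‖² for all z ∈ ℝⁿ, c₁′ > L_f ≥ 0. Let w̄ : [0,∞) → ℝ^m be differentiable with ‖w̄(t)‖ ≤ w_d, ‖w̄′(t)‖ ≤ w_d′, and let z̃ : [0,∞) → ℝⁿ, w̃ : [0,∞) → ℝ^m be differentiable solutions of z̃′ = g(t) − (c₁I + cL_e)z̃ − cBM(t)w̃, w̃′ = cM(t)ᵀBᵀz̃ + w̄′(t) + σ₁(w̄(t) − w̃(t)), with ‖g(t)‖ ≤ L_f‖z̃(t)‖ and M : [0,∞) → ℝ^{m×m} arbitrary. Fix δ > 0 such that σ₁′ := σ₁ − (σ₁+1)/(2δ²) > 0, and set c₁″ := min{c₁′ − L_f, σ₁′} and d := (δ²/2)(σ₁ w_d² + w_d′²). Then the composite error ξ(t) := (z̃(t), w̃(t)) satisfies ‖ξ(t)‖² ≤ e^{−2c₁″ t}‖ξ(0)‖² + d/c₁″ for all t ≥ 0; in particular ξ is globally uniformly bounded and converges to the residual set Ω :=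 {ξ : ‖ξ‖ ≤ √(d/c₁″)}. -/

import Mathlib

open RealInnerProductSpace Matrix Filter

/-- `M *ᵥ x` as a map between Euclidean spaces (so that `‖·‖` is the Euclidean norm). -/
noncomputable def mulVecE {n m : ℕ} (M : Matrix (Fin n) (Fin m) ℝ)
    (x : EuclideanSpace ℝ (Fin m)) : EuclideanSpace ℝ (Fin n) :=
  (WithLp.equiv 2 (Fin n → ℝ)).symm (M.mulVec ((WithLp.equiv 2 (Fin m → ℝ)) x))

theorem inner_mulVecE_transpose {n m : ℕ} (A : Matrix (Fin n) (Fin m) ℝ)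
    (x : EuclideanSpace ℝ (Fin n)) (y : EuclideanSpace ℝ (Fin m)) :
    ⟪y, mulVecE Aᵀ x⟫ = ⟪x, mulVecE A y⟫ := by
  simp only [mulVecE, EuclideanSpace.inner_eq_star_dotProduct, WithLp.equiv_apply,
    WithLp.equiv_symm_apply, star_trivial]
  rw [mulVec_transpose, dotProduct_comm (A *ᵥ _), dotProduct_mulVec]

/-- Young's inequality for inner products, with the second vector bounded in norm. -/
theorem inner_le_young_of_norm_le {E : Type*} [NormedAddCommGroup E] [InnerProductSpace ℝ E]
    {x y : E} {b δ : ℝ} (hδ : 0 < δ) (hy : ‖y‖ ≤ b) :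
    ⟪x, y⟫ ≤ ‖x‖ ^ 2 / (2 * δ ^ 2) + δ ^ 2 / 2 * b ^ 2 := by
  have hxy : ⟪x, y⟫ ≤ ‖x‖ * b :=
    (real_inner_le_norm x y).trans (mul_le_mul_of_nonneg_left hy (norm_nonneg x))
  have hsq : ‖x‖ ^ 2 / (2 * δ ^ 2) + δ ^ 2 / 2 * b ^ 2 - ‖x‖ * b
      = (‖x‖ / δ - δ * b) ^ 2 / 2 := by
    field_simp
    ring
  linarith [div_nonneg (sq_nonneg (‖x‖ / δ - δ * b)) zero_le_two]

/-- Comparison lemma for a linear differential inequality on `[0, ∞)`. -/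
theorem le_exp_mul_add_div_of_hasDerivAt_le {V V' : ℝ → ℝ} {a b : ℝ} (ha : 0 < a) (hb : 0 ≤ b)
    (hV : ∀ t ≥ 0, HasDerivAt V (V' t) t) (hV' : ∀ t ≥ 0, V' t ≤ -a * V t + b)
    {t : ℝ} (ht : 0 ≤ t) : V t ≤ Real.exp (-a * t) * V 0 + b / a := by
  have hder : ∀ s ≥ 0, HasDerivAt (fun s => Real.exp (a * s) * (V s - b / a))
      (Real.exp (a * s) * (a * (V s - b / a) + V' s)) s := fun s hs => by
    refine (((hasDerivAt_id' s).const_mul a).exp.mul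
      ((hV s hs).sub_const (b / a))).congr_deriv ?_
    ring
  have hanti : AntitoneOn (fun s => Real.exp (a * s) * (V s - b / a)) (Set.Ici 0) := by
    refine antitoneOn_of_deriv_nonpos (convex_Ici 0)
      (fun s hs => (hder s hs).continuousAt.continuousWithinAt)
      (fun s hs => (hder s (interior_subset hs)).differentiableAt.differentiableWithinAt)
      fun s hs => ?_
    have hs0 : s ≥ 0 := interior_subset hs
    rw [(hder s hs0).deriv]
    refine mul_nonpos_of_nonneg_of_nonpos (Real.exp_pos _).le ?_
    have hba : a * (V s - b / a) = a * V s - b := by field_simp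
    linarith [hV' s hs0]
  have h := hanti Set.self_mem_Ici ht ht
  simp only [mul_zero, Real.exp_zero, one_mul] at h
  have h' := mul_le_mul_of_nonneg_left h (Real.exp_pos (-a * t)).le
  rw [← mul_assoc, ← Real.exp_add] at h'
  have hcancel : -a * t + a * t = 0 := by ring
  rw [hcancel, Real.exp_zero, one_mul] at h'
  have hpos : 0 ≤ Real.exp (-a * t) * (b / a) := by positivity
  linarith [mul_sub (Real.exp (-a * t)) (V 0) (b / a)]

theorem limsup_sqrt_le_of_le_exp_mul_add {V : ℝ → ℝ} {a C r : ℝ} (ha : 0 < a)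
    (hV : ∀ t ≥ 0, V t ≤ Real.exp (-a * t) * C + r) :
    limsup (fun t => √(V t)) atTop ≤ √r := by
  have hexp : Tendsto (fun t => Real.exp (-a * t)) atTop (nhds 0) :=
    Real.tendsto_exp_atBot.comp (tendsto_id.const_mul_atTop_of_neg (neg_neg_of_pos ha))
  have hlim : Tendsto (fun t => √(Real.exp (-a * t) * C + r)) atTop (nhds √r) := by
    simpa using ((hexp.mul_const C).add_const r).sqrt
  rw [← hlim.limsup_eq]
  refine limsup_le_limsup ?_ ?_ hlim.isBoundedUnder_le
  · filter_upwards [eventually_ge_atTop 0] with t ht using Real.sqrt_le_sqrt (hV t ht)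
  · exact IsBoundedUnder.isCoboundedUnder_le
      (isBoundedUnder_of ⟨0, fun t => Real.sqrt_nonneg (V t)⟩)

/-- global uniform boundedness and ultimate boundedness of the σ-modified
closed-loop error dynamics of Proposition 2 (exponential transient plus residual set). -/
theorem stmt13 (n m : ℕ) (c c₁ σ₁ c₁' L_f w_d w_d' δ : ℝ)
    (hc : 0 < c) (hc₁ : 0 < c₁) (hσ₁ : 0 < σ₁) (hc₁' : 0 < c₁') (hLf : 0 ≤ L_f)
    (hc₁'Lf : L_f < c₁')
    (L_e : Matrix (Fin n) (Fin n) ℝ) (B : Matrix (Fin n) (Fin m) ℝ)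
    (hquad : ∀ z : EuclideanSpace ℝ (Fin n),
      c₁' * ‖z‖ ^ 2 ≤ ⟪z, mulVecE (c₁ • (1 : Matrix (Fin n) (Fin n) ℝ) + c • L_e) z⟫)
    (wbar wbar' : ℝ → EuclideanSpace ℝ (Fin m))
    (hwder : ∀ t : ℝ, HasDerivAt wbar (wbar' t) t)
    (hwb : ∀ t ≥ (0:ℝ), ‖wbar t‖ ≤ w_d ∧ ‖wbar' t‖ ≤ w_d')
    (M : ℝ → Matrix (Fin m) (Fin m) ℝ)
    (zt : ℝ → EuclideanSpace ℝ (Fin n)) (wt : ℝ → EuclideanSpace ℝ (Fin m))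
    (g : ℝ → EuclideanSpace ℝ (Fin n))
    (hg : ∀ t : ℝ, ‖g t‖ ≤ L_f * ‖zt t‖)
    (hzode : ∀ t : ℝ, HasDerivAt zt
      (g t - mulVecE (c₁ • (1 : Matrix (Fin n) (Fin n) ℝ) + c • L_e) (zt t)
        - c • mulVecE B (mulVecE (M t) (wt t))) t)
    (hwode : ∀ t : ℝ, HasDerivAt wt
      (c • mulVecE (M t)ᵀ (mulVecE Bᵀ (zt t)) + wbar' t + σ₁ • (wbar t - wt t)) t)
    (hδ : 0 < δ) (hσ₁' : 0 < σ₁ - (σ₁ + 1) / (2 * δ ^ 2)) :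
    (∀ t ≥ (0:ℝ),
      ‖zt t‖ ^ 2 + ‖wt t‖ ^ 2
        ≤ Real.exp (-2 * min (c₁' - L_f) (σ₁ - (σ₁ + 1) / (2 * δ ^ 2)) * t)
            * (‖zt 0‖ ^ 2 + ‖wt 0‖ ^ 2)
          + ((δ ^ 2 / 2) * (σ₁ * w_d ^ 2 + w_d' ^ 2))
              / min (c₁' - L_f) (σ₁ - (σ₁ + 1) / (2 * δ ^ 2)))
    ∧ limsup (fun t => Real.sqrt (‖zt t‖ ^ 2 + ‖wt t‖ ^ 2)) atTop
        ≤ Real.sqrt (((δ ^ 2 / 2) * (σ₁ * w_d ^ 2 + w_d' ^ 2))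
            / min (c₁' - L_f) (σ₁ - (σ₁ + 1) / (2 * δ ^ 2))) := by
  set k := min (c₁' - L_f) (σ₁ - (σ₁ + 1) / (2 * δ ^ 2))
  set d := (δ ^ 2 / 2) * (σ₁ * w_d ^ 2 + w_d' ^ 2) with hd
  have hkpos : 0 < k := lt_min (sub_pos.mpr hc₁'Lf) hσ₁'
  have hdnonneg : 0 ≤ d := by positivity
  have hbound : ∀ t ≥ (0:ℝ), ‖zt t‖ ^ 2 + ‖wt t‖ ^ 2
      ≤ Real.exp (-2 * k * t) * (‖zt 0‖ ^ 2 + ‖wt 0‖ ^ 2) + d / k := fun t ht => by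
    have h := le_exp_mul_add_div_of_hasDerivAt_le (a := 2 * k) (b := 2 * d)
      (by positivity) (by positivity)
      (fun s _ => (hzode s).norm_sq.add (hwode s).norm_sq) (fun s hs => ?_) ht
    · rwa [← neg_mul, mul_div_mul_left _ _ two_ne_zero] at h
    · obtain ⟨hw, hw'⟩ := hwb s hs
      have hyoung := inner_le_young_of_norm_le (x := wt s) hδ hw
      have hyoung' := inner_le_young_of_norm_le (x := wt s) hδ hw'
      have hgz : ⟪zt s, g s⟫ ≤ L_f * ‖zt s‖ ^ 2 := by
        calc ⟪zt s, g s⟫ ≤ ‖zt s‖ * ‖g s‖ := real_inner_le_norm _ _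
          _ ≤ ‖zt s‖ * (L_f * ‖zt s‖) := mul_le_mul_of_nonneg_left (hg s) (norm_nonneg _)
          _ = L_f * ‖zt s‖ ^ 2 := by ring
      have hkz : k * ‖zt s‖ ^ 2 ≤ (c₁' - L_f) * ‖zt s‖ ^ 2 :=
        mul_le_mul_of_nonneg_right (min_le_left _ _) (sq_nonneg _)
      have hkw : k * ‖wt s‖ ^ 2 ≤ (σ₁ - (σ₁ + 1) / (2 * δ ^ 2)) * ‖wt s‖ ^ 2 :=
        mul_le_mul_of_nonneg_right (min_le_right _ _) (sq_nonneg _)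
      have hσyoung := mul_le_mul_of_nonneg_left hyoung hσ₁.le
      simp only [inner_sub_right, inner_add_right, real_inner_smul_right,
        real_inner_self_eq_norm_sq, inner_mulVecE_transpose, Pi.add_apply]
      rw [real_inner_comm _ (mulVecE Bᵀ (zt s)), inner_mulVecE_transpose]
      have hsplit : (σ₁ - (σ₁ + 1) / (2 * δ ^ 2)) * ‖wt s‖ ^ 2
          = σ₁ * ‖wt s‖ ^ 2 - σ₁ * (‖wt s‖ ^ 2 / (2 * δ ^ 2)) - ‖wt s‖ ^ 2 / (2 * δ ^ 2) := by
        ring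
      linarith [hquad (zt s)]
  refine ⟨hbound, limsup_sqrt_le_of_le_exp_mul_add (a := 2 * k) (C := ‖zt 0‖ ^ 2 + ‖wt 0‖ ^ 2)
    (by positivity) fun t ht => ?_⟩
  rw [← neg_mul]
  exact hbound t ht
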